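/- Bicausal Talagrand inequality for the Gaussian: Let G^N be the standard Gaussian measure on ℝ^N (product of N standard one-dimensional Gaussians). Then for every Borel probability measure ν on ℝ^N, 2·Ent(ν | G^N) ≥ 𝒯_{bc,2}(G^N, ν) := inf_{γ ∈ Π_bc(G^N, ν)} ∫ Σ_{i≤N} |x_i − y_i|² dγ(x,y). -/

import Mathlib

open MeasureTheory ProbabilityTheory Set Filter
open scoped ENNReal NNReal BoundedContinuousFunction

noncomputable section

namespace CausalTransport

/-- The path space of a real-valued process in `N` time steps. -/
abbrev Path (N : ℕ) := Fin N → ℝ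

/-- Truncation of a path to its first `t` coordinates. -/
def proj (N t : ℕ) (x : Path N) : Fin t → ℝ :=
  fun i => if h : (i : ℕ) < N then x ⟨i, h⟩ else 0

/-- The coordinate with (0-based) index `t`, with junk value `0` if `t ≥ N`. -/
def coord (N t : ℕ) (x : Path N) : ℝ := if h : t < N then x ⟨t, h⟩ else 0

/-- The coordinates of a path after time `t`. -/
def tailProj (N t : ℕ) (x : Path N) : Fin (N - t) → ℝ := fun i => coord N (t + i) x

/-- Extension of a history of length `t` by one further value. -/
def snocFun (t : ℕ) (xs : Fin t → ℝ) (r : ℝ) : Fin (t + 1) → ℝ :=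
  fun i => if h : (i : ℕ) < t then xs ⟨i, h⟩ else r

/-- Extension of a history of length `t` to a full path (by `0`). -/
def pad (N t : ℕ) (xs : Fin t → ℝ) : Path N :=
  fun i => if h : (i : ℕ) < t then xs ⟨i, h⟩ else 0

/-- Glue the first `t` coordinates of `x` with the later coordinates `z`. -/
def glue (N t : ℕ) (x : Path N) (z : Fin (N - t) → ℝ) : Path N :=
  fun i => if (i : ℕ) < t then x i else
    if h : (i : ℕ) - t < N - t then z ⟨(i : ℕ) - t, h⟩ else 0

/-- Truncation of a pair of paths to the first `t` coordinates of each. -/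
def pairProj (N t : ℕ) (p : Path N × Path N) : (Fin t → ℝ) × (Fin t → ℝ) :=
  (proj N t p.1, proj N t p.2)

/-- The σ-algebra on path space generated by the first `t` coordinates. -/
def filt (N t : ℕ) : MeasurableSpace (Path N) :=
  MeasurableSpace.comap (proj N t) inferInstance

/-- `γ` is a transport plan (coupling) between `μ` and `ν`. -/
def IsCoupling {α β : Type*} [MeasurableSpace α] [MeasurableSpace β]
    (μ : Measure α) (ν : Measure β) (γ : Measure (α × β)) : Prop :=
  γ.map Prod.fst = μ ∧ γ.map Prod.snd = ν

/-- `γ` is a causal transport plan between `μ` and `ν`: it is a coupling and, for any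
disintegration `K` of `γ` over its first coordinate and any `t ∈ {1,…,N}`, the map
`x ↦ K x B` is measurable for the σ-algebra of the first `t` coordinates (up to `μ`-null
sets) whenever `B` is measurable for the first `t` coordinates. -/
def IsCausal (N : ℕ) (μ ν : Measure (Path N)) (γ : Measure (Path N × Path N)) : Prop :=
  IsCoupling μ ν γ ∧
  ∀ K : Kernel (Path N) (Path N), IsSFiniteKernel K → μ ⊗ₘ K = γ →
    ∀ t : ℕ, 1 ≤ t → t ≤ N → ∀ B : Set (Path N), MeasurableSet[filt N t] B →
      ∃ g : Path N → ℝ≥0∞, Measurable[filt N t] g ∧ (fun x => K x B) =ᵐ[μ] g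

/-- `γ` is a bicausal transport plan between `μ` and `ν`. -/
def IsBicausal (N : ℕ) (μ ν : Measure (Path N)) (γ : Measure (Path N × Path N)) : Prop :=
  IsCausal N μ ν γ ∧ IsCausal N ν μ (γ.map Prod.swap)

/-- Regular conditional distribution, under `μ`, of the coordinate of index `t`
given the first `t` coordinates. -/
def nextK (N : ℕ) (μ : Measure (Path N)) [IsFiniteMeasure μ] (t : ℕ) :
    Kernel (Fin t → ℝ) ℝ :=
  (μ.map (fun x => (proj N t x, coord N t x))).condKernel

/-- Regular conditional distribution, under `μ`, of all the coordinates after time `t`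
given the first `t` coordinates. -/
def tailK (N : ℕ) (μ : Measure (Path N)) [IsFiniteMeasure μ] (t : ℕ) :
    Kernel (Fin t → ℝ) (Fin (N - t) → ℝ) :=
  (μ.map (fun x => (proj N t x, tailProj N t x))).condKernel

/-- Regular conditional distribution, under `γ`, of the pair of coordinates of index `t`
given the first `t` coordinates of both paths. -/
def stepK (N : ℕ) (γ : Measure (Path N × Path N)) [IsFiniteMeasure γ] (t : ℕ) :
    Kernel ((Fin t → ℝ) × (Fin t → ℝ)) (ℝ × ℝ) :=
  (γ.map (fun p => (pairProj N t p, (coord N t p.1, coord N t p.2)))).condKernel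

/-- Regular conditional distribution, under `μ`, of the coordinate of index `t` given the
single coordinate of index `t-1` (one-step Markov transition kernel). -/
def mstep (N : ℕ) (μ : Measure (Path N)) [IsFiniteMeasure μ] (t : ℕ) : Kernel ℝ ℝ :=
  (μ.map (fun x => (coord N (t - 1) x, coord N t x))).condKernel

/-- `μ` is a Markov measure. -/
def IsMarkovMeasure (N : ℕ) (μ : Measure (Path N)) [IsFiniteMeasure μ] : Prop :=
  ∀ (t : ℕ) (ht : 1 ≤ t) (_ : t < N),
    ∀ᵐ xs ∂(μ.map (proj N t)), nextK N μ t xs = mstep N μ t (xs ⟨t - 1, by omega⟩)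

/-- A causal plan is causal quasi-Markov if (every version of) the conditional law of
`(x_{t+1}, y_{t+1})` given `(x_1,…,x_t,y_1,…,y_t)` depends a.s. only on `(x_t, y_1,…,y_t)`. -/
def IsQuasiMarkov (N : ℕ) (γ : Measure (Path N × Path N)) : Prop :=
  ∀ (t : ℕ) (ht : 1 ≤ t) (_ : t < N),
    ∀ S : Kernel ((Fin t → ℝ) × (Fin t → ℝ)) (ℝ × ℝ), IsSFiniteKernel S →
      (γ.map (pairProj N t)) ⊗ₘ S
          = γ.map (fun p => (pairProj N t p, (coord N t p.1, coord N t p.2))) →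
      ∃ κ : Kernel (ℝ × (Fin t → ℝ)) (ℝ × ℝ),
        ∀ᵐ z ∂(γ.map (pairProj N t)), S z = κ (z.1 ⟨t - 1, by omega⟩, z.2)

/-- Topological support of a measure. -/
def msupport {α : Type*} [TopologicalSpace α] [MeasurableSpace α] (μ : Measure α) : Set α :=
  {x | ∀ U : Set α, IsOpen U → x ∈ U → μ U ≠ 0}

/-- `K` is a version of the disintegration of `μ` at time `t` which is weakly continuous on
the support of the first `t` coordinates of `μ`. -/
def WeaklyContinuousDisintegration (N t : ℕ) (μ : Measure (Path N))
    (K : Kernel (Fin t → ℝ) (Fin (N - t) → ℝ)) : Prop :=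
  IsMarkovKernel K ∧
  (μ.map (proj N t)) ⊗ₘ K = μ.map (fun x => (proj N t x, tailProj N t x)) ∧
  ∀ f : (Fin (N - t) → ℝ) →ᵇ ℝ,
    ContinuousOn (fun xs => ∫ z, f z ∂(K xs)) (msupport (μ.map (proj N t)))

/-- `μ` is successively weakly continuous. -/
def SuccWeakCont (N : ℕ) (μ : Measure (Path N)) : Prop :=
  ∀ t : ℕ, t < N → ∃ K : Kernel (Fin t → ℝ) (Fin (N - t) → ℝ),
    WeaklyContinuousDisintegration N t μ K

/-- The cumulative distribution function of a measure on `ℝ`. -/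
def cdf1 (η : Measure ℝ) (z : ℝ) : ℝ := (η (Iic z)).toReal

/-- The left-continuous generalized inverse (quantile function) of the c.d.f. of `η`. -/
def qinv (η : Measure ℝ) (u : ℝ) : ℝ := sInf {y : ℝ | u ≤ cdf1 η y}

/-- Partial Knothe–Rosenblatt path built from the "uniform" inputs `u`. -/
def krPartial (N : ℕ) (μ : Measure (Path N)) [IsFiniteMeasure μ] (u : ℕ → ℝ) :
    (t : ℕ) → Fin t → ℝ
  | 0 => Fin.elim0
  | t + 1 => snocFun t (krPartial N μ u t)
      (qinv (nextK N μ t (krPartial N μ u t)) (u t))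

/-- The Knothe–Rosenblatt (quantile transform) path built from uniform inputs. -/
def krPath (N : ℕ) (μ : Measure (Path N)) [IsFiniteMeasure μ] (u : Path N) : Path N :=
  krPartial N μ (fun n => if h : n < N then u ⟨n, h⟩ else 0) N

/-- The uniform distribution on `[0,1]`. -/
def unif01 : Measure ℝ := volume.restrict (Icc (0 : ℝ) 1)

instance : IsProbabilityMeasure unif01 := by
  constructor
  simp [unif01, Real.volume_Icc]

/-- N independent uniforms on `[0,1]`. -/
def uniformCube (N : ℕ) : Measure (Path N) := Measure.pi fun _ => unif01

instance (N : ℕ) : IsProbabilityMeasure (uniformCube N) :=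
  inferInstanceAs (IsProbabilityMeasure (Measure.pi fun _ : Fin N => unif01))

/-- The (increasing) Knothe–Rosenblatt rearrangement of `(μ, ν)`: the joint law of
`(X*, Y*)` where both paths are built from the same independent uniforms. -/
def krCoupling (N : ℕ) (μ ν : Measure (Path N)) [IsFiniteMeasure μ] [IsFiniteMeasure ν] :
    Measure (Path N × Path N) :=
  (uniformCube N).map (fun u => (krPath N μ u, krPath N ν u))

/-- Partial Knothe–Rosenblatt Monge map. -/
def krMapPartial (N : ℕ) (μ ν : Measure (Path N)) [IsFiniteMeasure μ] [IsFiniteMeasure ν]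
    (x : Path N) : (t : ℕ) → Fin t → ℝ
  | 0 => Fin.elim0
  | t + 1 => snocFun t (krMapPartial N μ ν x t)
      (qinv (nextK N ν t (krMapPartial N μ ν x t))
        (cdf1 (nextK N μ t (proj N t x)) (coord N t x)))

/-- The Knothe–Rosenblatt Monge map from `μ` to `ν`. -/
def krMap (N : ℕ) (μ ν : Measure (Path N)) [IsFiniteMeasure μ] [IsFiniteMeasure ν]
    (x : Path N) : Path N :=
  krMapPartial N μ ν x N

open Classical in
/-- Relative entropy `Ent(ν|μ)`, via the nonnegative integrand `f log f - f + 1`,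
`f = dν/dμ`; equals `∫ log (dν/dμ) dν` for probability measures. -/
def relEnt {α : Type*} [MeasurableSpace α] (ν μ : Measure α) : ℝ≥0∞ :=
  if ν ≪ μ then
    ∫⁻ x, ENNReal.ofReal
      ((ν.rnDeriv μ x).toReal * Real.log (ν.rnDeriv μ x).toReal
        - (ν.rnDeriv μ x).toReal + 1) ∂μ
  else ∞

/-- Universally measurable `ℝ≥0∞`-valued function. -/
def UnivMeasurable {α : Type*} [MeasurableSpace α] (f : α → ℝ≥0∞) : Prop :=
  ∀ P : Measure α, IsFiniteMeasure P → AEMeasurable f P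

/-- The standard Gaussian measure on `ℝ^N`. -/
def stdGaussian (N : ℕ) : Measure (Path N) := Measure.pi fun _ => gaussianReal 0 1

section Aux

open Topology InformationTheory

/-- standard Gaussian density on the line -/
def gphi (x : ℝ) : ℝ := gaussianPDFReal 0 1 x

lemma gphi_eq (x : ℝ) : gphi x = (√(2 * Real.pi))⁻¹ * Real.exp (-(x ^ 2) / 2) := by
  simp [gphi, gaussianPDFReal]

lemma gphi_pos (x : ℝ) : 0 < gphi x := gaussianPDFReal_pos _ _ _ one_ne_zero

lemma gphi_neg (x : ℝ) : gphi (-x) = gphi x := by simp [gphi_eq]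

lemma continuous_gphi : Continuous gphi := by
  have : gphi = fun x => (√(2 * Real.pi))⁻¹ * Real.exp (-(x ^ 2) / 2) := funext gphi_eq
  rw [this]; fun_prop

lemma hasDerivAt_neg_gphi (x : ℝ) : HasDerivAt (fun z => - gphi z) (x * gphi x) x := by
  have : gphi = fun x => (√(2 * Real.pi))⁻¹ * Real.exp (-(x ^ 2) / 2) := funext gphi_eq
  rw [this]
  have h1 : HasDerivAt (fun x : ℝ => -(x ^ 2) / 2) (-x) x := by
    have := (hasDerivAt_pow 2 x).fun_neg.div_const 2
    refine this.congr_deriv ?_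
    simp
    ring
  refine ((h1.exp).const_mul ((√(2 * Real.pi))⁻¹)).fun_neg.congr_deriv ?_
  ring

lemma tendsto_neg_gphi : Tendsto (fun z => - gphi z) atTop (𝓝 0) := by
  have : gphi = fun x => (√(2 * Real.pi))⁻¹ * Real.exp (-(x ^ 2) / 2) := funext gphi_eq
  rw [this]
  have h : Tendsto (fun x : ℝ => -(x ^ 2) / 2) atTop atBot := by
    have : Tendsto (fun x : ℝ => x ^ 2 / 2) atTop atTop :=
      (tendsto_pow_atTop (two_ne_zero)).atTop_div_const (by norm_num)
    have := tendsto_neg_atTop_atBot.comp this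
    refine this.congr fun x => ?_
    simp; ring
  have := ((Real.tendsto_exp_atBot.comp h).const_mul ((√(2 * Real.pi))⁻¹)).neg
  simpa using this

lemma gphi_eq_lintegral {x : ℝ} (hx : 0 ≤ x) :
    ENNReal.ofReal (gphi x) = ∫⁻ z in Ioi x, ENNReal.ofReal (z * gphi z) := by
  have hpos : ∀ z ∈ Ioi x, 0 ≤ z * gphi z := fun z hz =>
    mul_nonneg (hx.trans (le_of_lt hz)) (gphi_pos z).le
  have hintg : IntegrableOn (fun z => z * gphi z) (Ioi x) :=
    integrableOn_Ioi_deriv_of_nonneg' (fun z _ => hasDerivAt_neg_gphi z) hpos tendsto_neg_gphi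
  have := integral_Ioi_of_hasDerivAt_of_tendsto' (a := x) (fun z _ => hasDerivAt_neg_gphi z)
    hintg tendsto_neg_gphi
  rw [← ofReal_integral_eq_lintegral_ofReal hintg, this]
  · simp
  · exact (ae_restrict_iff' measurableSet_Ioi).2 (ae_of_all _ hpos)

lemma lintegral_deriv_le {T : ℝ → ℝ} (hT : Monotone T) {z : ℝ} (hz : 0 ≤ z) :
    ∫⁻ x in Ioc 0 z, ENNReal.ofReal (deriv T x) ≤ ENNReal.ofReal (T z - T 0) := by
  have h1 := (hT.monotoneOn (uIcc 0 z)).intervalIntegral_deriv_mem_uIcc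
  have h2 := (hT.monotoneOn (uIcc 0 z)).intervalIntegrable_deriv
  rw [uIcc_of_le (by linarith [hT hz])] at h1
  rw [intervalIntegral.integral_of_le hz] at h1
  have h3 : IntegrableOn (deriv T) (Ioc 0 z) := (intervalIntegrable_iff_integrableOn_Ioc_of_le hz).1 h2
  rw [← ofReal_integral_eq_lintegral_ofReal h3 (ae_of_all _ fun x => hT.deriv_nonneg)]
  exact ENNReal.ofReal_le_ofReal h1.2

lemma half_line {T : ℝ → ℝ} (hT : Monotone T) :
    ∫⁻ x in Ioi 0, ENNReal.ofReal (deriv T x) * ENNReal.ofReal (gphi x)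
      ≤ ∫⁻ z in Ioi 0, ENNReal.ofReal (gphi z * (z * (T z - T 0))) := by
  have hm : Measurable (deriv T) := measurable_deriv T
  have hg : Measurable gphi := continuous_gphi.measurable
  calc ∫⁻ x in Ioi 0, ENNReal.ofReal (deriv T x) * ENNReal.ofReal (gphi x)
      = ∫⁻ x in Ioi 0, ∫⁻ z in Ioi 0, (Ioi x).indicator
          (fun z => ENNReal.ofReal (deriv T x) * ENNReal.ofReal (z * gphi z)) z := by
        refine setLIntegral_congr_fun measurableSet_Ioi fun x hx => ?_
        rw [lintegral_indicator measurableSet_Ioi, Measure.restrict_restrict measurableSet_Ioi,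
          lintegral_const_mul _ (by fun_prop), gphi_eq_lintegral (le_of_lt hx)]
        congr 3
        ext z; simp only [mem_inter_iff, mem_Ioi] at *
        exact ⟨fun h => ⟨h, hx.trans h⟩, fun h => h.1⟩
    _ = ∫⁻ z in Ioi 0, ∫⁻ x in Ioi 0, (Ioi x).indicator
          (fun z => ENNReal.ofReal (deriv T x) * ENNReal.ofReal (z * gphi z)) z := by
        refine lintegral_lintegral_swap ?_
        have : (Function.uncurry fun (x z : ℝ) => (Ioi x).indicator
          (fun z => ENNReal.ofReal (deriv T x) * ENNReal.ofReal (z * gphi z)) z)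
          = {p : ℝ × ℝ | p.1 < p.2}.indicator
          (fun p => ENNReal.ofReal (deriv T p.1) * ENNReal.ofReal (p.2 * gphi p.2)) := by
          ext ⟨x, z⟩
          simp [Function.uncurry, indicator]
        rw [this]
        exact (Measurable.indicator (by fun_prop)
          (measurableSet_lt measurable_fst measurable_snd)).aemeasurable
    _ ≤ _ := by
        refine setLIntegral_mono' measurableSet_Ioi fun z hz => ?_
        have hz : 0 < z := hz
        calc ∫⁻ x in Ioi 0, (Ioi x).indicator
              (fun z => ENNReal.ofReal (deriv T x) * ENNReal.ofReal (z * gphi z)) z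
            = ∫⁻ x in Ioi 0, (Iio z).indicator
              (fun x => ENNReal.ofReal (deriv T x) * ENNReal.ofReal (z * gphi z)) x := by
              congr 1
          _ ≤ (∫⁻ x in Ioc 0 z, ENNReal.ofReal (deriv T x)) * ENNReal.ofReal (z * gphi z) := by
              rw [lintegral_indicator measurableSet_Iio,
                Measure.restrict_restrict measurableSet_Iio, lintegral_mul_const _ (by fun_prop)]
              gcongr
              intro x hx
              exact ⟨hx.2, le_of_lt hx.1⟩
          _ ≤ ENNReal.ofReal (T z - T 0) * ENNReal.ofReal (z * gphi z) := by
              gcongr; exact lintegral_deriv_le hT hz.le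
          _ = _ := by
              rw [← ENNReal.ofReal_mul (by linarith [hT hz.le])]
              congr 1; ring

lemma lintegral_Iio_neg (f : ℝ → ℝ≥0∞) :
    ∫⁻ x in Iio 0, f x = ∫⁻ x in Ioi 0, f (-x) := by
  have := (Measure.measurePreserving_neg (volume : Measure ℝ)).setLIntegral_comp_preimage_emb
    (MeasurableEquiv.neg ℝ).measurableEmbedding f (Iio 0)
  rw [← this]
  simp

lemma half_line' {T : ℝ → ℝ} (hT : Monotone T) :
    ∫⁻ x in Iio 0, ENNReal.ofReal (deriv T x) * ENNReal.ofReal (gphi x)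
      ≤ ∫⁻ z in Iio 0, ENNReal.ofReal (gphi z * (z * (T z - T 0))) := by
  have h := half_line (T := fun x => - T (-x)) (fun a b hab => neg_le_neg (hT (neg_le_neg hab)))
  rw [lintegral_Iio_neg, lintegral_Iio_neg]
  convert h using 5 with x x
  · have := deriv_comp_neg (fun x => T x) x
    rw [deriv.fun_neg, this]; simp
  · exact (gphi_neg _).symm ▸ rfl
  · rw [gphi_neg]
  · simp; ring

lemma lintegral_split (f : ℝ → ℝ≥0∞) :
    ∫⁻ x, f x = (∫⁻ x in Iio 0, f x) + ∫⁻ x in Ioi 0, f x := by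
  rw [← lintegral_add_compl f (measurableSet_Iio (a := (0:ℝ))), compl_Iio,
    setLIntegral_congr Ioi_ae_eq_Ici]

lemma lintegral_gauss (f : ℝ → ℝ≥0∞) :
    ∫⁻ x, f x ∂(gaussianReal 0 1) = ∫⁻ x, f x * ENNReal.ofReal (gphi x) := by
  rw [gaussianReal_of_var_ne_zero _ one_ne_zero,
    lintegral_withDensity_eq_lintegral_mul_non_measurable _ (measurable_gaussianPDF _ _)]
  · simp [gaussianPDF, gphi, mul_comm]
  · exact ae_of_all _ fun x => by simp [gaussianPDF]

lemma gauss_ibp {T : ℝ → ℝ} (hT : Monotone T)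
    (h2 : MemLp T 2 (gaussianReal 0 1)) :
    ∫⁻ x, ENNReal.ofReal (deriv T x) ∂(gaussianReal 0 1)
      ≤ ENNReal.ofReal (∫ x, x * T x ∂(gaussianReal 0 1)) := by
  have hid : MemLp (fun x : ℝ => x) 2 (gaussianReal 0 1) := memLp_id_gaussianReal' 2 (by simp)
  have hi1 : Integrable (fun x : ℝ => x * T x) (gaussianReal 0 1) := hid.integrable_mul h2
  have hi2 : Integrable (fun x : ℝ => x * T 0) (gaussianReal 0 1) :=
    (hid.integrable (by norm_num)).mul_const _
  have hi3 : Integrable (fun x : ℝ => x * (T x - T 0)) (gaussianReal 0 1) := by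
    simp_rw [mul_sub]
    exact hi1.sub hi2
  have hpos : ∀ z, 0 ≤ z * (T z - T 0) := fun z => by
    rcases le_total 0 z with h | h
    · exact mul_nonneg h (by linarith [hT h])
    · exact mul_nonneg_of_nonpos_of_nonpos h (by linarith [hT h])
  have heq : ∫ x, x * T x ∂(gaussianReal 0 1) = ∫ x, x * (T x - T 0) ∂(gaussianReal 0 1) := by
    simp_rw [mul_sub]
    rw [integral_sub hi1 hi2, integral_mul_const, integral_id_gaussianReal]
    simp
  rw [heq, ofReal_integral_eq_lintegral_ofReal hi3 (ae_of_all _ hpos), lintegral_gauss,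
    lintegral_gauss, lintegral_split, lintegral_split (fun x => ENNReal.ofReal (x * (T x - T 0)) * _)]
  have : ∀ z, ENNReal.ofReal (z * (T z - T 0)) * ENNReal.ofReal (gphi z)
      = ENNReal.ofReal (gphi z * (z * (T z - T 0))) := fun z => by
    rw [← ENNReal.ofReal_mul (hpos z), mul_comm]
  simp_rw [this]
  exact add_le_add (half_line' hT) (half_line hT)

lemma cdf1_eq (η : Measure ℝ) [IsProbabilityMeasure η] (z : ℝ) : cdf1 η z = cdf η z := by
  rw [cdf_eq_real]; rfl

lemma qinv_le_iff (η : Measure ℝ) [IsProbabilityMeasure η] {u : ℝ} (h0 : 0 < u) (h1 : u < 1)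
    (c : ℝ) : qinv η u ≤ c ↔ u ≤ cdf η c := by
  unfold qinv
  simp_rw [cdf1_eq]
  set A := {y : ℝ | u ≤ cdf η y} with hA
  have hne : A.Nonempty := by
    obtain ⟨y, hy⟩ := ((tendsto_cdf_atTop η).eventually (lt_mem_nhds h1)).exists
    exact ⟨y, hy.le⟩
  have hbd : BddBelow A := by
    obtain ⟨y, hy⟩ := ((tendsto_cdf_atBot η).eventually (gt_mem_nhds h0)).exists
    refine ⟨y, fun z hz => ?_⟩
    by_contra! h
    exact absurd ((hz : u ≤ cdf η z).trans (monotone_cdf η h.le)) (not_le.2 hy)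
  constructor
  · intro h
    have hr : Tendsto (cdf η) (𝓝[>] c) (𝓝 (cdf η c)) :=
      ((cdf η).right_continuous c).tendsto.mono_left (nhdsWithin_mono _ Ioi_subset_Ici_self)
    refine ge_of_tendsto hr ?_
    filter_upwards [self_mem_nhdsWithin] with y hy
    obtain ⟨z, hz, hzy⟩ := (csInf_lt_iff hbd hne).1 (lt_of_le_of_lt h hy)
    exact (hz : u ≤ cdf η z).trans (monotone_cdf η hzy.le)
  · intro h
    exact csInf_le hbd h

lemma cdf_continuous (η : Measure ℝ) [IsProbabilityMeasure η] (h : η ≪ volume) :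
    Continuous (cdf η) := by
  refine continuous_iff_continuousAt.2 fun x => ?_
  rw [(monotone_cdf η).continuousAt_iff_leftLim_eq_rightLim, (cdf η).rightLim_eq]
  have : (cdf η).measure {x} = 0 := by rw [measure_cdf]; exact h (by simp)
  rw [StieltjesFunction.measure_singleton, ENNReal.ofReal_eq_zero] at this
  exact le_antisymm ((monotone_cdf η).leftLim_le le_rfl) (by linarith)

lemma cdf_qinv (η : Measure ℝ) [IsProbabilityMeasure η] (h : η ≪ volume) {u : ℝ}
    (h0 : 0 < u) (h1 : u < 1) : cdf η (qinv η u) = u := by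
  refine le_antisymm ?_ ((qinv_le_iff η h0 h1 _).1 le_rfl)
  have hr : Tendsto (cdf η) (𝓝[<] (qinv η u)) (𝓝 (cdf η (qinv η u))) :=
    (cdf_continuous η h).continuousAt.tendsto.mono_left nhdsWithin_le_nhds
  refine le_of_tendsto hr ?_
  filter_upwards [self_mem_nhdsWithin] with y hy
  by_contra! hlt
  exact absurd ((qinv_le_iff η h0 h1 _).2 hlt.le) (not_le.2 hy)

/-- the one-dimensional standard Gaussian measure -/
abbrev g1 : Measure ℝ := gaussianReal 0 1

lemma g1_ac : g1 ≪ volume := gaussianReal_absolutelyContinuous 0 one_ne_zero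

lemma g1_ac' : volume ≪ g1 := gaussianReal_absolutelyContinuous' 0 one_ne_zero

lemma cdf_g1_strictMono : StrictMono (cdf g1) := by
  intro a b hab
  have h : (cdf g1).measure (Ioc a b) ≠ 0 := by
    rw [measure_cdf]
    intro h
    have := g1_ac' h
    simp at this
    linarith
  rw [StieltjesFunction.measure_Ioc, ne_eq, ENNReal.ofReal_eq_zero] at h
  linarith

lemma cdf_g1_pos (x : ℝ) : 0 < cdf g1 x :=
  lt_of_le_of_lt (cdf_nonneg g1 (x - 1)) (cdf_g1_strictMono (by linarith))

lemma cdf_g1_lt_one (x : ℝ) : cdf g1 x < 1 :=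
  lt_of_lt_of_le (cdf_g1_strictMono (by linarith : x < x + 1)) (cdf_le_one g1 (x + 1))

lemma g1_cdf_le {u : ℝ} (h0 : 0 ≤ u) (h1 : u ≤ 1) :
    g1 {x | cdf g1 x ≤ u} = ENNReal.ofReal u := by
  rcases h0.eq_or_lt with rfl | h0
  · have : {x | cdf g1 x ≤ 0} = ∅ := by
      ext x; simpa using cdf_g1_pos x
    simp [this]
  rcases h1.eq_or_lt with rfl | h1
  · have : {x | cdf g1 x ≤ 1} = univ := by
      ext x; simpa using cdf_le_one g1 x
    simp [this]
  have h2 := cdf_qinv g1 g1_ac h0 h1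
  have : {x | cdf g1 x ≤ u} = Iic (qinv g1 u) := by
    ext x
    simp only [mem_ofPred_eq, mem_Iic]
    nth_rw 1 [← h2]
    exact cdf_g1_strictMono.le_iff_le
  rw [this, ← ofReal_cdf, h2]

/-- monotone rearrangement of the Gaussian onto `η` -/
def tmap (η : Measure ℝ) (x : ℝ) : ℝ := qinv η (cdf g1 x)

lemma tmap_le_iff (η : Measure ℝ) [IsProbabilityMeasure η] (x c : ℝ) :
    tmap η x ≤ c ↔ cdf g1 x ≤ cdf η c := qinv_le_iff η (cdf_g1_pos x) (cdf_g1_lt_one x) c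

lemma tmap_mono (η : Measure ℝ) [IsProbabilityMeasure η] : Monotone (tmap η) := by
  intro a b hab
  rw [tmap_le_iff]
  exact (monotone_cdf g1 hab).trans ((tmap_le_iff η b _).1 le_rfl)

lemma tmap_map (η : Measure ℝ) [IsProbabilityMeasure η] : g1.map (tmap η) = η := by
  have hm := (tmap_mono η).measurable
  have : IsProbabilityMeasure (g1.map (tmap η)) :=
    Measure.isProbabilityMeasure_map hm.aemeasurable
  refine Measure.ext_of_Iic _ _ fun c => ?_
  rw [Measure.map_apply hm measurableSet_Iic, ← ofReal_cdf, ← g1_cdf_le (cdf_nonneg η c) (cdf_le_one η c)]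
  congr 1
  ext x
  simp [tmap_le_iff]

lemma cdf_tmap (η : Measure ℝ) [IsProbabilityMeasure η] (h : η ≪ volume) (x : ℝ) :
    cdf η (tmap η x) = cdf g1 x := cdf_qinv η h (cdf_g1_pos x) (cdf_g1_lt_one x)

lemma tmap_measurable {α : Type*} [MeasurableSpace α] (κ : Kernel α ℝ) [IsMarkovKernel κ] :
    Measurable (fun p : α × ℝ => tmap (κ p.1) p.2) := by
  refine measurable_of_Iic fun c => ?_
  have : (fun p : α × ℝ => tmap (κ p.1) p.2) ⁻¹' Iic c
      = {p | ENNReal.ofReal (cdf g1 p.2) ≤ κ p.1 (Iic c)} := by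
    ext p
    simp only [mem_preimage, mem_Iic, tmap_le_iff, mem_ofPred_eq]
    rw [← ofReal_cdf, ENNReal.ofReal_le_ofReal_iff (cdf_nonneg _ _)]
  rw [this]
  refine measurableSet_le ?_ ?_
  · exact ((monotone_cdf g1).measurable.comp measurable_snd).ennreal_ofReal
  · exact (κ.measurable_coe measurableSet_Iic).comp measurable_fst

lemma exists_psi : ∃ Ψ : ℝ → ℝ, Measurable Ψ ∧ ∀ x, Ψ (cdf g1 x) = x := by
  have he : MeasurableEmbedding (cdf g1) :=
    (monotone_cdf g1).measurable.measurableEmbedding cdf_g1_strictMono.injective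
  obtain ⟨Ψ, h1, h2⟩ := he.exists_measurable_extend measurable_id (fun _ => ⟨0⟩)
  exact ⟨Ψ, h1, fun x => congrFun h2 x⟩

/-- measurable left inverse of the Gaussian distribution function -/
def psi : ℝ → ℝ := exists_psi.choose

lemma psi_measurable : Measurable psi := exists_psi.choose_spec.1

lemma psi_cdf (x : ℝ) : psi (cdf g1 x) = x := exists_psi.choose_spec.2 x

/-- inverse map of `tmap` -/
def smap (η : Measure ℝ) (y : ℝ) : ℝ := psi (η (Iic y)).toReal

lemma smap_tmap (η : Measure ℝ) [IsProbabilityMeasure η] (h : η ≪ volume) (x : ℝ) :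
    smap η (tmap η x) = x := by
  have : (η (Iic (tmap η x))).toReal = cdf η (tmap η x) := by rw [cdf_eq_real]; rfl
  rw [smap, this, cdf_tmap η h, psi_cdf]

lemma smap_measurable {α : Type*} [MeasurableSpace α] (κ : Kernel α ℝ) [IsMarkovKernel κ] :
    Measurable (fun p : α × ℝ => smap (κ p.1) p.2) := by
  refine psi_measurable.comp (Measurable.ennreal_toReal ?_)
  have hs : MeasurableSet {q : (α × ℝ) × ℝ | q.2 ≤ q.1.2} :=
    measurableSet_le measurable_snd (measurable_snd.comp measurable_fst)
  have := Kernel.measurable_kernel_prodMk_left (κ := κ.comap Prod.fst measurable_fst) hs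
  exact this

lemma young_klFun {a b : ℝ} (ha : 0 ≤ a) : a * b ≤ klFun a + Real.exp b - 1 := by
  rw [klFun_apply]
  rcases ha.eq_or_lt with rfl | ha
  · simp; positivity
  have h := Real.add_one_le_exp (b - Real.log a)
  rw [Real.exp_sub, Real.exp_log ha, le_div_iff₀ ha] at h
  nlinarith

lemma integrable_exp_sq : Integrable (fun x : ℝ => Real.exp (x ^ 2 / 4)) g1 := by
  unfold g1
  rw [gaussianReal_of_var_ne_zero _ one_ne_zero, integrable_withDensity_iff_integrable_smul'
    (measurable_gaussianPDF _ _) (ae_of_all _ fun x => by simp [gaussianPDF])]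
  have h := (integrable_exp_neg_mul_sq (b := 1 / 4) (by norm_num)).const_mul ((√(2 * Real.pi))⁻¹)
  refine h.congr (ae_of_all _ fun x => ?_)
  have : (gaussianPDF 0 1 x).toReal = gphi x := by
    simp [gaussianPDF, gphi, ENNReal.toReal_ofReal (gaussianPDFReal_nonneg _ _ _)]
  simp only [this, gphi_eq, smul_eq_mul]
  rw [mul_assoc, ← Real.exp_add]
  congr 2
  ring

lemma second_moment (η : Measure ℝ) [IsProbabilityMeasure η] (hac : η ≪ g1)
    (hintg : Integrable (llr η g1) η) : Integrable (fun y : ℝ => y ^ 2) η := by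
  have hk : Integrable (fun x => klFun (η.rnDeriv g1 x).toReal) g1 :=
    (integrable_klFun_rnDeriv_iff hac).2 hintg
  have h1 : Integrable (fun x => (η.rnDeriv g1 x).toReal • (x ^ 2 / 4)) g1 := by
    refine Integrable.mono' ((hk.add integrable_exp_sq).sub (integrable_const 1)) ?_ ?_
    · exact Measurable.aestronglyMeasurable (by fun_prop)
    · refine ae_of_all _ fun x => ?_
      rw [Real.norm_of_nonneg (by positivity)]
      simpa using young_klFun (a := (η.rnDeriv g1 x).toReal) (b := x ^ 2 / 4) (by positivity)
  have h2 := (integrable_rnDeriv_smul_iff hac).1 h1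
  refine (h2.mul_const 4).congr (ae_of_all _ fun x => ?_)
  simp

lemma key_deriv (η : Measure ℝ) [IsProbabilityMeasure η] (hac : η ≪ g1) :
    ∀ᵐ x ∂g1, llr η g1 (tmap η x) ≥ ((tmap η x) ^ 2 - x ^ 2) / 2 - deriv (tmap η) x + 1 := by
  have hacv : η ≪ volume := hac.trans g1_ac
  have hm := (tmap_mono η).measurable
  have hA : ∀ᵐ y, HasDerivAt (cdf η) ((η.rnDeriv g1 y).toReal * gphi y) y := by
    have h1 := (cdf η).ae_hasDerivAt
    rw [measure_cdf] at h1
    filter_upwards [h1, Measure.rnDeriv_mul_rnDeriv (κ := volume) hac, rnDeriv_gaussianReal 0 1]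
      with y hy1 hy2 hy3
    rw [← hy2, Pi.mul_apply, hy3, ENNReal.toReal_mul] at hy1
    simpa [gaussianPDF, gphi, ENNReal.toReal_ofReal (gaussianPDFReal_nonneg _ _ _)] using hy1
  have hB : ∀ᵐ x, HasDerivAt (cdf g1) (gphi x) x := by
    have h1 := (cdf g1).ae_hasDerivAt
    rw [measure_cdf] at h1
    filter_upwards [h1, rnDeriv_gaussianReal 0 1] with y hy1 hy3
    rw [hy3] at hy1
    simpa [gaussianPDF, gphi, ENNReal.toReal_ofReal (gaussianPDFReal_nonneg _ _ _)] using hy1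
  have hA' : ∀ᵐ x ∂g1, HasDerivAt (cdf η)
      ((η.rnDeriv g1 (tmap η x)).toReal * gphi (tmap η x)) (tmap η x) := by
    have : ∀ᵐ y ∂(g1.map (tmap η)), HasDerivAt (cdf η) ((η.rnDeriv g1 y).toReal * gphi y) y := by
      rw [tmap_map]; exact hacv.ae_le hA
    exact ae_of_ae_map hm.aemeasurable this
  filter_upwards [hA', g1_ac.ae_le hB, g1_ac.ae_le (tmap_mono η).ae_differentiableAt]
    with x h1 h2 h3
  have h4 := h1.comp x h3.hasDerivAt
  have h5 : (cdf η) ∘ (tmap η) = cdf g1 := funext fun x => cdf_tmap η hacv x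
  rw [h5] at h4
  have h6 := h4.unique h2
  set r := (η.rnDeriv g1 (tmap η x)).toReal with hr
  set d := deriv (tmap η) x with hd
  have hr0 : 0 ≤ r := ENNReal.toReal_nonneg
  have hd0 : 0 ≤ d := (tmap_mono η).deriv_nonneg
  have hpx := gphi_pos x
  have hr1 : 0 < r := lt_of_le_of_ne hr0 fun h => by
    rw [← h] at h6; simp at h6; linarith
  have hd1 : 0 < d := lt_of_le_of_ne hd0 fun h => by
    rw [← h] at h6; simp at h6; linarith
  have hlog := congrArg Real.log h6
  rw [Real.log_mul (mul_pos hr1 (gphi_pos _)).ne' hd1.ne', Real.log_mul hr1.ne' (gphi_pos _).ne',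
    gphi_eq, gphi_eq, Real.log_mul (by positivity) (by positivity),
    Real.log_mul (by positivity) (by positivity), Real.log_exp, Real.log_exp] at hlog
  have hl : llr η g1 (tmap η x) = Real.log r := rfl
  rw [hl]
  have := Real.log_le_sub_one_of_pos hd1
  linarith

theorem talagrand_one (η : Measure ℝ) [IsProbabilityMeasure η] :
    ∫⁻ x, ENNReal.ofReal ((x - tmap η x) ^ 2) ∂g1 ≤ 2 * klDiv η g1 := by
  by_cases htop : klDiv η g1 = ∞
  · rw [htop]; simp
  obtain ⟨hac, hintg⟩ := klDiv_ne_top_iff.1 htop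
  have hm := (tmap_mono η).measurable
  have hT2 : Integrable (fun x => (tmap η x) ^ 2) g1 := by
    have := second_moment η hac hintg
    rw [← tmap_map η] at this
    exact this.comp_measurable hm
  have hLp : MemLp (tmap η) 2 g1 := (memLp_two_iff_integrable_sq hm.aestronglyMeasurable).2 hT2
  have hid : MemLp (fun x : ℝ => x) 2 g1 := memLp_id_gaussianReal' 2 (by simp)
  have hx2 : Integrable (fun x : ℝ => x ^ 2) g1 := hid.integrable_sq
  have hxT : Integrable (fun x : ℝ => x * tmap η x) g1 := hid.integrable_mul hLp
  have hibp := gauss_ibp (tmap_mono η) hLp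
  have hd0 : ∀ x, 0 ≤ deriv (tmap η) x := fun x => (tmap_mono η).deriv_nonneg
  have hdint : Integrable (deriv (tmap η)) g1 := by
    refine (lintegral_ofReal_ne_top_iff_integrable
      (measurable_deriv _).aestronglyMeasurable (ae_of_all _ hd0)).1 ?_
    exact (lt_of_le_of_lt hibp ENNReal.ofReal_lt_top).ne
  have hxT0 : 0 ≤ ∫ x, x * tmap η x ∂g1 := by
    have h1 : Integrable (fun x : ℝ => x * tmap η 0) g1 :=
      (hid.integrable (by norm_num)).mul_const _
    have h2 : ∫ x, x * tmap η x ∂g1 = ∫ x, (x * tmap η x - x * tmap η 0) ∂g1 := by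
      rw [integral_sub hxT h1, integral_mul_const, integral_id_gaussianReal]
      simp
    rw [h2]
    refine integral_nonneg fun z => ?_
    simp only [Pi.zero_apply, ← mul_sub]
    rcases le_total 0 z with h | h
    · exact mul_nonneg h (by linarith [tmap_mono η h])
    · exact mul_nonneg_of_nonpos_of_nonpos h (by linarith [tmap_mono η h])
  have hd : ∫ x, deriv (tmap η) x ∂g1 ≤ ∫ x, x * tmap η x ∂g1 := by
    rw [← ofReal_integral_eq_lintegral_ofReal hdint (ae_of_all _ hd0)] at hibp
    exact (ENNReal.ofReal_le_ofReal_iff hxT0).1 hibp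
  have hl : Integrable (fun x => llr η g1 (tmap η x)) g1 := by
    have := hintg
    nth_rw 2 [← tmap_map η] at this
    exact this.comp_measurable hm
  have hleq : ∫ x, llr η g1 (tmap η x) ∂g1 = ∫ y, llr η g1 y ∂η := by
    have := integral_map (μ := g1) hm.aemeasurable (f := llr η g1)
      (measurable_llr _ _).aestronglyMeasurable
    rw [← this, tmap_map]
  have hvar : ∫ x : ℝ, x ^ 2 ∂g1 = 1 := by
    have := variance_fun_id_gaussianReal (μ := 0) (v := 1)
    rw [variance_eq_integral measurable_id'.aemeasurable] at this
    simpa using this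
  have hmain : ∫ x, (x - tmap η x) ^ 2 ∂g1 ≤ 2 * ∫ y, llr η g1 y ∂η := by
    have h1 : ∫ x, (((tmap η x) ^ 2 - x ^ 2) / 2 - deriv (tmap η) x + 1) ∂g1
        ≤ ∫ x, llr η g1 (tmap η x) ∂g1 :=
      integral_mono_ae ((((hT2.sub hx2).div_const 2).sub hdint).add (integrable_const 1)) hl
        (key_deriv η hac)
    have h2 : ∫ x, (((tmap η x) ^ 2 - x ^ 2) / 2 - deriv (tmap η) x + 1) ∂g1
        = ((∫ x, (tmap η x) ^ 2 ∂g1) - 1) / 2 - (∫ x, deriv (tmap η) x ∂g1) + 1 := by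
      have i1 : Integrable (fun x => ((tmap η x) ^ 2 - x ^ 2) / 2) g1 :=
        (hT2.sub hx2).div_const 2
      have i2 : Integrable (fun x => ((tmap η x) ^ 2 - x ^ 2) / 2 - deriv (tmap η) x) g1 :=
        i1.sub hdint
      rw [integral_add i2 (integrable_const 1), integral_sub i1 hdint, integral_div, integral_sub hT2 hx2, hvar]
      simp
    have h3 : ∫ x, (x - tmap η x) ^ 2 ∂g1
        = 1 - 2 * (∫ x, x * tmap η x ∂g1) + ∫ x, (tmap η x) ^ 2 ∂g1 := by
      have : ∀ x, (x - tmap η x) ^ 2 = x ^ 2 - 2 * (x * tmap η x) + (tmap η x) ^ 2 := by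
        intro x; ring
      simp_rw [this]
      have i1 : Integrable (fun x => x ^ 2 - 2 * (x * tmap η x)) g1 := hx2.sub (hxT.const_mul 2)
      rw [integral_add i1 hT2, integral_sub hx2 (hxT.const_mul 2),
        integral_const_mul, hvar]
    rw [h2, hleq] at h1
    rw [h3]
    linarith
  have i3 : Integrable (fun x => (x - tmap η x) ^ 2) g1 := (hid.sub hLp).integrable_sq
  rw [← ofReal_integral_eq_lintegral_ofReal i3
    (ae_of_all _ fun x => sq_nonneg _), klDiv_of_ac_of_integrable hac hintg]
  have : (2 : ℝ≥0∞) = ENNReal.ofReal 2 := by simp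
  rw [this, ← ENNReal.ofReal_mul (by norm_num)]
  refine ENNReal.ofReal_le_ofReal ?_
  simpa using hmain

lemma klDiv_compProd_right_eq {α : Type*} [MeasurableSpace α] (μ : Measure α)
    [IsProbabilityMeasure μ] (κ η : Kernel α ℝ) [IsMarkovKernel κ] [IsMarkovKernel η]
    (hac : μ ⊗ₘ κ ≪ μ ⊗ₘ η) :
    klDiv (μ ⊗ₘ κ) (μ ⊗ₘ η) = ∫⁻ a, klDiv (κ a) (η a) ∂μ := by
  have hk : ∀ᵐ a ∂μ, κ a ≪ η a := Measure.absolutelyContinuous_compProd_right_iff.1 hac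
  have hm : Measurable (fun p : α × ℝ => Kernel.rnDeriv κ η p.1 p.2) :=
    Kernel.measurable_rnDeriv κ η
  have hd : μ ⊗ₘ κ = (μ ⊗ₘ η).withDensity (fun p => Kernel.rnDeriv κ η p.1 p.2) := by
    ext s hs
    rw [withDensity_apply _ hs, ← lintegral_indicator hs, Measure.lintegral_compProd
      (hm.indicator hs), Measure.compProd_apply hs]
    refine lintegral_congr_ae ?_
    filter_upwards [hk] with a ha
    have hs' : MeasurableSet (Prod.mk a ⁻¹' s) := measurable_prodMk_left hs
    have h1 : κ a = (η a).withDensity (Kernel.rnDeriv κ η a) := by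
      rw [withDensity_congr_ae (Kernel.rnDeriv_eq_rnDeriv_measure (κ := κ) (η := η) (a := a)),
        Measure.withDensity_rnDeriv_eq _ _ ha]
    conv_lhs => rw [h1]
    rw [withDensity_apply _ hs', ← lintegral_indicator hs']
    rfl
  have hr : (μ ⊗ₘ κ).rnDeriv (μ ⊗ₘ η) =ᵐ[μ ⊗ₘ η] fun p => Kernel.rnDeriv κ η p.1 p.2 := by
    conv_lhs => rw [hd]
    exact Measure.rnDeriv_withDensity _ hm
  rw [klDiv_eq_lintegral_klFun_of_ac hac]
  have : ∫⁻ p, ENNReal.ofReal (klFun ((μ ⊗ₘ κ).rnDeriv (μ ⊗ₘ η) p).toReal) ∂(μ ⊗ₘ η)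
      = ∫⁻ p, ENNReal.ofReal (klFun (Kernel.rnDeriv κ η p.1 p.2).toReal) ∂(μ ⊗ₘ η) := by
    refine lintegral_congr_ae ?_
    filter_upwards [hr] with p hp
    rw [hp]
  rw [this, Measure.lintegral_compProd (by fun_prop)]
  refine lintegral_congr_ae ?_
  filter_upwards [hk] with a ha
  rw [klDiv_eq_lintegral_klFun_of_ac ha]
  refine lintegral_congr_ae ?_
  filter_upwards [Kernel.rnDeriv_eq_rnDeriv_measure (κ := κ) (η := η) (a := a)] with b hb
  rw [hb]

/-- adapted (non-anticipative) maps of the path space -/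
def AdaptedMap (N : ℕ) (T : Path N → Path N) : Prop :=
  ∀ (x x' : Path N) (i : Fin N), (∀ j ≤ i, x j = x' j) → T x i = T x' i

lemma measurable_proj (N t : ℕ) : Measurable (proj N t) := by
  refine measurable_pi_lambda _ fun i => ?_
  unfold proj
  split_ifs <;> fun_prop

lemma measurable_pad (N t : ℕ) : Measurable (pad N t) := by
  refine measurable_pi_lambda _ fun i => ?_
  unfold pad
  split_ifs <;> fun_prop

lemma AdaptedMap.proj_pad {N : ℕ} {T : Path N → Path N} (hT : AdaptedMap N T) (t : ℕ)
    (x : Path N) : proj N t (T (pad N t (proj N t x))) = proj N t (T x) := by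
  ext i
  unfold proj
  split_ifs with h
  · refine hT _ _ _ fun j hj => ?_
    have hj' : (j : ℕ) < t := lt_of_le_of_lt (Fin.le_def.1 hj) i.2
    simp [pad, hj']
  · rfl

lemma causal_of_adapted {N : ℕ} {μ ν : Measure (Path N)} [IsProbabilityMeasure μ]
    {T : Path N → Path N} (hTm : Measurable T) (hT : AdaptedMap N T) (hmap : μ.map T = ν) :
    IsCausal N μ ν (μ.map (fun x => (x, T x))) := by
  have hm2 : Measurable (fun x => (x, T x)) := measurable_id.prodMk hTm
  refine ⟨⟨?_, ?_⟩, ?_⟩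
  · rw [Measure.map_map measurable_fst hm2]
    exact Measure.map_id
  · rw [Measure.map_map measurable_snd hm2]
    exact hmap
  · rintro K hK hKeq t - - B ⟨B', hB', rfl⟩
    have hB : MeasurableSet (proj N t ⁻¹' B') := measurable_proj N t hB'
    have hg : Measurable (fun z : Fin t → ℝ =>
        B'.indicator (fun _ => (1 : ℝ≥0∞)) (proj N t (T (pad N t z)))) :=
      (measurable_const.indicator hB').comp
        ((measurable_proj N t).comp (hTm.comp (measurable_pad N t)))
    refine ⟨fun x => B'.indicator (fun _ => (1 : ℝ≥0∞)) (proj N t (T (pad N t (proj N t x)))),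
      ?_, ?_⟩
    · exact hg.comp (comap_measurable (proj N t))
    · refine ae_eq_of_forall_setLIntegral_eq_of_sigmaFinite (K.measurable_coe hB)
        (hg.comp (measurable_proj N t)) fun s hs _ => ?_
      rw [← Measure.compProd_apply_prod hs hB, hKeq, Measure.map_apply hm2 (hs.prod hB)]
      simp_rw [hT.proj_pad]
      have : (fun x => B'.indicator (fun _ => (1 : ℝ≥0∞)) (proj N t (T x)))
          = (T ⁻¹' (proj N t ⁻¹' B')).indicator (fun _ => 1) := by
        rfl
      rw [this, lintegral_indicator (hTm hB), setLIntegral_const, one_mul,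
        Measure.restrict_apply (hTm hB)]
      congr 1
      ext x; simp [and_comm]

lemma bicausal_of_adapted {N : ℕ} {μ ν : Measure (Path N)} [IsProbabilityMeasure μ]
    {T S : Path N → Path N} (hTm : Measurable T) (hSm : Measurable S)
    (hT : AdaptedMap N T) (hS : AdaptedMap N S) (hmap : μ.map T = ν)
    (hST : ∀ᵐ x ∂μ, S (T x) = x) :
    IsBicausal N μ ν (μ.map (fun x => (x, T x))) := by
  refine ⟨causal_of_adapted hTm hT hmap, ?_⟩
  have : IsProbabilityMeasure ν := hmap ▸ Measure.isProbabilityMeasure_map hTm.aemeasurable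
  have h1 : (μ.map (fun x => (x, T x))).map Prod.swap = ν.map (fun y => (y, S y)) := by
    rw [← hmap, Measure.map_map measurable_swap (measurable_id'.prodMk hTm),
      Measure.map_map (measurable_id'.prodMk hSm) hTm]
    refine Measure.map_congr ?_
    filter_upwards [hST] with x hx
    simp [hx]
  rw [h1]
  refine causal_of_adapted hSm hS ?_
  rw [← hmap, Measure.map_map hSm hTm]
  conv_rhs => rw [← Measure.map_id (μ := μ)]
  exact Measure.map_congr hST

instance (N : ℕ) : IsProbabilityMeasure (stdGaussian N) :=
  inferInstanceAs (IsProbabilityMeasure (Measure.pi fun _ : Fin N => gaussianReal 0 1))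

/-- splitting off the last coordinate -/
def splitE (N : ℕ) : Path (N + 1) ≃ᵐ Path N × ℝ :=
  (MeasurableEquiv.piFinSuccAbove (fun _ => ℝ) (Fin.last N)).trans MeasurableEquiv.prodComm

lemma splitE_fst (N : ℕ) (x : Path (N + 1)) (j : Fin N) : (splitE N x).1 j = x j.castSucc := by
  have : (splitE N x).1 j = x ((Fin.last N).succAbove j) := rfl
  rw [this, Fin.succAbove_last]

lemma splitE_snd (N : ℕ) (x : Path (N + 1)) : (splitE N x).2 = x (Fin.last N) := rfl

lemma splitE_symm_castSucc (N : ℕ) (p : Path N × ℝ) (j : Fin N) :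
    (splitE N).symm p j.castSucc = p.1 j := by
  rw [← splitE_fst N ((splitE N).symm p) j, MeasurableEquiv.apply_symm_apply]

lemma splitE_symm_last (N : ℕ) (p : Path N × ℝ) :
    (splitE N).symm p (Fin.last N) = p.2 := by
  rw [← splitE_snd N ((splitE N).symm p), MeasurableEquiv.apply_symm_apply]

lemma splitE_map (N : ℕ) :
    (stdGaussian (N + 1)).map (splitE N) = (stdGaussian N).prod g1 := by
  have h1 := measurePreserving_piFinSuccAbove (fun _ : Fin (N + 1) => g1) (Fin.last N)
  have h2 := (Measure.measurePreserving_swap (μ := g1) (ν := stdGaussian N)).comp h1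
  exact h2.map_eq

/-- extension of an adapted map by one step -/
def stepMap {N : ℕ} (T : Path N → Path N) (w : Path N × ℝ → ℝ) (x : Path (N + 1)) :
    Path (N + 1) :=
  (splitE N).symm (T (splitE N x).1, w (splitE N x))

lemma stepMap_adapted {N : ℕ} {T : Path N → Path N} (hT : AdaptedMap N T) (w : Path N × ℝ → ℝ) :
    AdaptedMap (N + 1) (stepMap T w) := by
  intro x x' i h
  induction i using Fin.lastCases with
  | last =>
    have : x = x' := funext fun j => h j (Fin.le_last j)
    rw [this]
  | cast i =>
    unfold stepMap
    rw [splitE_symm_castSucc, splitE_symm_castSucc]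
    refine hT _ _ _ fun j hj => ?_
    rw [splitE_fst, splitE_fst]
    exact h _ (by simpa using hj)

lemma stepMap_measurable {N : ℕ} {T : Path N → Path N} (hT : Measurable T) {w : Path N × ℝ → ℝ}
    (hw : Measurable w) : Measurable (stepMap T w) :=
  (splitE N).symm.measurable.comp
    ((hT.comp (measurable_fst.comp (splitE N).measurable)).prodMk (hw.comp (splitE N).measurable))

theorem exists_maps (N : ℕ) : ∀ (ν : Measure (Path N)) [IsProbabilityMeasure ν],
    ν ≪ stdGaussian N → ∃ T S : Path N → Path N, Measurable T ∧ Measurable S ∧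
      AdaptedMap N T ∧ AdaptedMap N S ∧ (stdGaussian N).map T = ν ∧
      (∀ᵐ x ∂(stdGaussian N), S (T x) = x) ∧
      ∫⁻ x, ∑ i, ENNReal.ofReal ((x i - T x i) ^ 2) ∂(stdGaussian N)
        ≤ 2 * klDiv ν (stdGaussian N) := by
  induction N with
  | zero =>
    intro ν _ _
    refine ⟨id, id, measurable_id, measurable_id, fun x x' i => i.elim0, fun x x' i => i.elim0,
      ?_, by simp, by simp⟩
    rw [Measure.map_id]
    ext s hs
    rcases s.eq_empty_or_nonempty with rfl | h
    · simp
    · rw [Subsingleton.eq_univ_of_nonempty h]; simp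
  | succ N ih =>
    intro ν _ hac
    set E := splitE N with hE
    set ρ := ν.map E with hρ
    have : IsProbabilityMeasure ρ := Measure.isProbabilityMeasure_map E.measurable.aemeasurable
    set κ := ρ.condKernel with hκ
    set ν1 := ρ.fst with hν1
    have hdis : ν1 ⊗ₘ κ = ρ := ρ.disintegrate ρ.condKernel
    set c : Kernel (Path N) ℝ := Kernel.const (Path N) g1 with hc
    have hprod : (stdGaussian N).prod g1 = stdGaussian N ⊗ₘ c := by
      rw [hc, Measure.compProd_const]
    have hρac : ν1 ⊗ₘ κ ≪ stdGaussian N ⊗ₘ c := by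
      rw [hdis, ← hprod, ← splitE_map]
      exact hac.map E.measurable
    obtain ⟨hac1, hac2⟩ := Measure.absolutelyContinuous_compProd_iff.1 hρac
    have hac3 : ∀ᵐ a ∂ν1, κ a ≪ g1 := Measure.absolutelyContinuous_compProd_right_iff.1 hac2
    obtain ⟨T1, S1, hT1m, hS1m, hT1, hS1, hmap1, hST1, hcost1⟩ := ih ν1 hac1
    set w : Path N × ℝ → ℝ := fun p => tmap (κ (T1 p.1)) p.2 with hw
    set v : Path N × ℝ → ℝ := fun p => smap (κ p.1) p.2 with hv
    have hwm : Measurable w := (tmap_measurable κ).comp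
      ((hT1m.comp measurable_fst).prodMk measurable_snd)
    have hvm : Measurable v := smap_measurable κ
    set τ : Path N × ℝ → Path N × ℝ := fun p => (T1 p.1, w p) with hτ
    have hτm : Measurable τ := (hT1m.comp measurable_fst).prodMk hwm
    have hτmap : ((stdGaussian N).prod g1).map τ = ρ := by
      rw [← hdis]
      ext s hs
      rw [Measure.map_apply hτm hs, Measure.prod_apply (hτm hs), Measure.compProd_apply hs,
        ← hmap1, lintegral_map (Kernel.measurable_kernel_prodMk_left hs) hT1m]
      refine lintegral_congr fun a => ?_
      conv_rhs => rw [← tmap_map (κ (T1 a))]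
      rw [Measure.map_apply (tmap_mono _).measurable (measurable_prodMk_left hs)]
      rfl
    refine ⟨stepMap T1 w, stepMap S1 v, stepMap_measurable hT1m hwm, stepMap_measurable hS1m hvm,
      stepMap_adapted hT1 w, stepMap_adapted hS1 v, ?_, ?_, ?_⟩
    · have : stepMap T1 w = E.symm ∘ τ ∘ E := rfl
      rw [this, ← Measure.map_map E.symm.measurable (hτm.comp E.measurable),
        ← Measure.map_map hτm E.measurable, splitE_map, hτmap, hρ,
        Measure.map_map E.symm.measurable E.measurable]
      simp
    · have hac4 : ∀ᵐ a ∂(stdGaussian N), κ (T1 a) ≪ g1 := by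
        rw [← hmap1] at hac3
        exact ae_of_ae_map hT1m.aemeasurable hac3
      have h1 : ∀ᵐ p ∂((stdGaussian N).prod g1), S1 (T1 p.1) = p.1 ∧ κ (T1 p.1) ≪ g1 :=
        Measure.quasiMeasurePreserving_fst.ae (hST1.and hac4)
      rw [← splitE_map] at h1
      filter_upwards [ae_of_ae_map E.measurable.aemeasurable h1] with x hx
      unfold stepMap
      rw [MeasurableEquiv.apply_symm_apply, MeasurableEquiv.symm_apply_eq]
      refine Prod.ext hx.1 ?_
      exact smap_tmap _ (hx.2.trans g1_ac) _
    · have hkl : klDiv ν1 (stdGaussian N) + ∫⁻ a, klDiv (κ a) g1 ∂ν1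
          ≤ klDiv ν (stdGaussian (N + 1)) := by
        have h1 := klDiv_map_le (μ := ν) (ν := stdGaussian (N + 1)) E.measurable
        rw [splitE_map, hprod, ← hρ, ← hdis, klDiv_compProd_eq_add,
          klDiv_compProd_right_eq _ _ _ hac2] at h1
        exact h1
      have hF : Measurable (fun p : Path N × ℝ =>
          ∑ i, ENNReal.ofReal ((p.1 i - T1 p.1 i) ^ 2)) := by fun_prop
      have hH : Measurable (fun p : Path N × ℝ => ENNReal.ofReal ((p.2 - w p) ^ 2)) := by fun_prop
      have hkm : ∫⁻ a, ∫⁻ b, ENNReal.ofReal ((b - w (a, b)) ^ 2) ∂g1 ∂(stdGaussian N)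
          ≤ 2 * ∫⁻ a, klDiv (κ a) g1 ∂ν1 := by
        have hm : Measurable (fun y => ∫⁻ b, ENNReal.ofReal ((b - tmap (κ y) b) ^ 2) ∂g1) := by
          have := tmap_measurable κ
          have h2 : Measurable (fun p : Path N × ℝ =>
            ENNReal.ofReal ((p.2 - tmap (κ p.1) p.2) ^ 2)) := by fun_prop
          exact h2.lintegral_prod_right'
        calc _ = ∫⁻ y, ∫⁻ b, ENNReal.ofReal ((b - tmap (κ y) b) ^ 2) ∂g1 ∂ν1 := by
              rw [← hmap1, lintegral_map hm hT1m]
          _ ≤ ∫⁻ y, 2 * klDiv (κ y) g1 ∂ν1 := lintegral_mono fun y => talagrand_one (κ y)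
          _ = _ := lintegral_const_mul' _ _ (by simp)
      calc ∫⁻ x, ∑ i, ENNReal.ofReal ((x i - stepMap T1 w x i) ^ 2) ∂(stdGaussian (N + 1))
          = ∫⁻ x, (fun p : Path N × ℝ => (∑ i, ENNReal.ofReal ((p.1 i - T1 p.1 i) ^ 2))
              + ENNReal.ofReal ((p.2 - w p) ^ 2)) (E x) ∂(stdGaussian (N + 1)) := by
            refine lintegral_congr fun x => ?_
            rw [Fin.sum_univ_castSucc]
            simp only [stepMap, splitE_symm_castSucc, splitE_symm_last, splitE_snd, hE, splitE_fst]
        _ = ∫⁻ p, (∑ i, ENNReal.ofReal ((p.1 i - T1 p.1 i) ^ 2))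
              + ENNReal.ofReal ((p.2 - w p) ^ 2) ∂((stdGaussian N).prod g1) := by
            have hFH : Measurable (fun p : Path N × ℝ =>
                (∑ i, ENNReal.ofReal ((p.1 i - T1 p.1 i) ^ 2))
                  + ENNReal.ofReal ((p.2 - w p) ^ 2)) := hF.add hH
            rw [← splitE_map, lintegral_map hFH (splitE N).measurable]
        _ = (∫⁻ a, ∑ i, ENNReal.ofReal ((a i - T1 a i) ^ 2) ∂(stdGaussian N))
            + ∫⁻ a, ∫⁻ b, ENNReal.ofReal ((b - w (a, b)) ^ 2) ∂g1 ∂(stdGaussian N) := by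
            rw [lintegral_add_left hF, lintegral_prod _ hF.aemeasurable,
              lintegral_prod _ hH.aemeasurable]
            simp
        _ ≤ 2 * klDiv ν1 (stdGaussian N) + 2 * ∫⁻ a, klDiv (κ a) g1 ∂ν1 :=
            add_le_add hcost1 hkm
        _ ≤ _ := by
            rw [← mul_add]
            gcongr

end Aux

theorem bicausal_talagrand_inequality
    (N : ℕ) (ν : Measure (Path N)) [IsProbabilityMeasure ν] :
    (⨅ (γ : Measure (Path N × Path N)) (_ : IsBicausal N (stdGaussian N) ν γ),
        ∫⁻ p, ∑ i, ENNReal.ofReal ((p.1 i - p.2 i) ^ 2) ∂γ)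
      ≤ 2 * relEnt ν (stdGaussian N) := by
  by_cases hac : ν ≪ stdGaussian N
  · obtain ⟨T, S, hTm, hSm, hT, hS, hmap, hST, hcost⟩ := exists_maps N ν hac
    have hrel : relEnt ν (stdGaussian N) = InformationTheory.klDiv ν (stdGaussian N) := by
      rw [InformationTheory.klDiv_eq_lintegral_klFun_of_ac hac, relEnt, if_pos hac]
      refine lintegral_congr fun x => ?_
      rw [InformationTheory.klFun_apply]
      congr 1
      ring
    rw [hrel]
    refine le_trans (iInf₂_le _ (bicausal_of_adapted hTm hSm hT hS hmap hST)) ?_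
    rw [lintegral_map (by fun_prop) (measurable_id'.prodMk hTm)]
    exact hcost
  · rw [relEnt, if_neg hac]
    simp

end CausalTransport
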